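/- Let h ∈ ℝ^{m*} ≅ g₁, let T: P → S^k ℝ^m ⊗ Hom(V₁,V₂) be smooth, and let f: P → V₁ be smooth and infinitesimally G₀-equivariant with respect to σ₁. Then L_{ω^{-1}(h)}(Q_ω(T)f) − Q_ω(T)(L_{ω^{-1}(h)}f) = Q_ω(L_{ω^{-1}(h)}T + γ(h)∘T)(f), where γ(h) is applied to T pointwise and h is regarded as the element of g₁ ⊂ sl(m+1,ℝ) with ξ-block h. -/

import Mathlib

open scoped BigOperators
noncomputable section
namespace ProjQuant

/-- `ℝ^m`. -/
abbrev Rm (m : ℕ) := Fin m → ℝ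

/-- The index set for `(m+1) × (m+1)` matrices, split into blocks. -/
abbrev Idx (m : ℕ) := Sum (Fin m) Unit

/-- `gl(m,ℝ)`, realized as continuous linear endomorphisms of `ℝ^m`. -/
abbrev GLm (m : ℕ) := (Fin m → ℝ) →L[ℝ] (Fin m → ℝ)

/-- `ℝ^{m*}`. -/
abbrev Dualm (m : ℕ) := (Fin m → ℝ) →L[ℝ] ℝ

/-- The vector field `X^M` on `ℝ^m` attached to a matrix
`M = [[A, v], [ξ, a]] ∈ sl(m+1,ℝ)`, namely `X^M(x) = -v - A x + a x + ξ(x) x`. -/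
def projVF (m : ℕ) (M : Matrix (Idx m) (Idx m) ℝ) : Rm m → Rm m := fun x i =>
  -(M (Sum.inl i) (Sum.inr ())) - (∑ j, M (Sum.inl i) (Sum.inl j) * x j)
    + M (Sum.inr ()) (Sum.inr ()) * x i
    + (∑ j, M (Sum.inr ()) (Sum.inl j) * x j) * x i

/-- The Lie derivative of a `V`-valued function along a vector field `X`, with respect to a
representation `σ` of `gl(m,ℝ)` on `V`:  `(L_X f)(x) = Df(x)[X(x)] - σ(DX(x))(f(x))`. -/
def lieD (m : ℕ) {V : Type} [NormedAddCommGroup V] [NormedSpace ℝ V]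
    (σ : GLm m → V → V) (X : Rm m → Rm m) (f : Rm m → V) : Rm m → V :=
  fun x => fderiv ℝ f x (X x) - σ (fderiv ℝ X x) (f x)

/-- `σ` is a Lie algebra representation of `gl(m,ℝ)`. -/
def IsLieRep (m : ℕ) {V : Type} [NormedAddCommGroup V] [NormedSpace ℝ V]
    (σ : GLm m →ₗ[ℝ] (V →L[ℝ] V)) : Prop :=
  ∀ A B : GLm m, σ (A ∘L B - B ∘L A) = σ A ∘L σ B - σ B ∘L σ A


/-- Iterated Lie derivative along the constant fields `X^{hᵢ} = -hᵢ`, outermost first. -/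
def lieItC (m : ℕ) {V : Type} [NormedAddCommGroup V] [NormedSpace ℝ V]
    (σ : GLm m → V → V) : (k : ℕ) → (Fin k → Rm m) → (Rm m → V) → (Rm m → V)
  | 0, _, f => f
  | (k+1), v, f => lieD m σ (fun _ => -(v 0)) (lieItC m σ k (fun j => v j.succ) f)

section Symbols

variable (m : ℕ) (V₁ V₂ : Type)
  [NormedAddCommGroup V₁] [NormedSpace ℝ V₁] [NormedAddCommGroup V₂] [NormedSpace ℝ V₂]

/-- The model for `S^k ℝ^m ⊗ Hom(V₁,V₂)`: multilinear maps on `k` copies of `ℝ^{m*}`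
with values in `Hom(V₁,V₂)` (symbols of degree `k` are the symmetric ones). -/
abbrev Symb (k : ℕ) := ContinuousMultilinearMap ℝ (fun _ : Fin k => Dualm m) (V₁ →L[ℝ] V₂)

/-- The decomposable tensor `h₁ ⊗ ⋯ ⊗ h_k ⊗ A` in the model. -/
def pureT {k : ℕ} (v : Fin k → Rm m) (A : V₁ →L[ℝ] V₂) : Symb m V₁ V₂ k :=
  (ContinuousMultilinearMap.mkPiRing ℝ (Fin k) A).compContinuousLinearMap
    (fun i => ContinuousLinearMap.apply ℝ ℝ (v i))

/-- The symmetric product `h₁ ∨ ⋯ ∨ h_k ⊗ A` in the model. -/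
def symT {k : ℕ} (v : Fin k → Rm m) (A : V₁ →L[ℝ] V₂) : Symb m V₁ V₂ k :=
  ∑ ν : Equiv.Perm (Fin k), pureT m V₁ V₂ (v ∘ ν) A

/-- The subspace of the model corresponding to `S^k ℝ^m ⊗ Hom(V₁,V₂)` itself:
the span of the symmetric products. -/
def spanGen (k : ℕ) : Submodule ℝ (Symb m V₁ V₂ k) :=
  Submodule.span ℝ {T | ∃ (v : Fin k → Rm m) (A : V₁ →L[ℝ] V₂), T = symT m V₁ V₂ v A}

/-- The rank-one endomorphism `u ⊗ h : x ↦ h(x) • u` of `ℝ^m`. -/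
def rkOne (u : Rm m) (h : Dualm m) : GLm m := h.smulRight u

variable (σ₁ : GLm m →ₗ[ℝ] (V₁ →L[ℝ] V₁)) (σ₂ : GLm m →ₗ[ℝ] (V₂ →L[ℝ] V₂))

/-- The representation `σ^{(k)}` of `gl(m,ℝ)` on `S^k ℝ^m ⊗ Hom(V₁,V₂)`, determined by
`σ^{(k)}(B)(h₁∨⋯∨h_k ⊗ A) = Σᵢ h₁∨⋯∨(B hᵢ)∨⋯∨h_k ⊗ A + h₁∨⋯∨h_k ⊗ (σ₂(B)∘A - A∘σ₁(B))`. -/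
def sigmaS {k : ℕ} (B : GLm m) (T : Symb m V₁ V₂ k) : Symb m V₁ V₂ k :=
  (∑ t : Fin k, T.compContinuousLinearMap
    (fun s => if s = t then (ContinuousLinearMap.compL ℝ (Rm m) (Rm m) ℝ).flip B
      else ContinuousLinearMap.id ℝ (Dualm m)))
  + ((ContinuousLinearMap.compL ℝ V₁ V₂ V₂ (σ₂ B))
      - (ContinuousLinearMap.compL ℝ V₁ V₁ V₂).flip (σ₁ B)).compContinuousMultilinearMap T

/-- The `i`-th coordinate covector on `ℝ^m`. -/
def coordD (i : Fin m) : Dualm m := ContinuousLinearMap.proj i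

/-- The affine quantization (standard ordering): the full contraction of a degree-`k` symbol
with the `k`-th derivative, `Q_Aff(h₁∨⋯∨h_k ⊗ A)(f) = A(∂_{h₁} ⋯ ∂_{h_k} f)`. -/
def QAff {k : ℕ} (T : Rm m → Symb m V₁ V₂ k) (f : Rm m → V₁) : Rm m → V₂ :=
  fun x => (k.factorial : ℝ)⁻¹ • ∑ d : Fin k → Fin m,
    (T x (fun t => coordD m (d t))) (iteratedFDeriv ℝ k f x (fun t => Pi.single (d t) 1))

/-- The defining property of the map `γ(h) : S^{k+1} ℝ^m ⊗ Hom(V₁,V₂) → S^k ℝ^m ⊗ Hom(V₁,V₂)`,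
for `h ∈ ℝ^{m*} ≅ 𝔤₁`:
`γ(h)(h₁∨⋯∨h_{k+1} ⊗ A) = Σᵢ h₁∨⋯(omit hᵢ)⋯∨h_{k+1} ⊗ (A ∘ σ₁(hᵢ⊗h + h(hᵢ)·Id))`
`- Σᵢ Σ_{j<i} h₁∨⋯(omit hⱼ,hᵢ)⋯∨h_{k+1} ∨ (h(hⱼ)·hᵢ + h(hᵢ)·hⱼ) ⊗ A`. -/
def gammaProp {k : ℕ}
    (γ : Dualm m → (Symb m V₁ V₂ (k+1) →ₗ[ℝ] Symb m V₁ V₂ k)) : Prop :=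
  ∀ (h : Dualm m) (v : Fin (k+1) → Rm m) (A : V₁ →L[ℝ] V₂),
    γ h (symT m V₁ V₂ v A) =
      (∑ i : Fin (k+1), symT m V₁ V₂ (i.removeNth v)
        (A.comp (σ₁ (rkOne m (v i) h + h (v i) • ContinuousLinearMap.id ℝ (Rm m)))))
      - ∑ i : Fin (k+1), ∑ j : Fin k,
          if (i.succAbove j : ℕ) < (i : ℕ) then
            symT m V₁ V₂ (i.removeNth (Function.update v (i.succAbove j)
              (h (v (i.succAbove j)) • v i + h (v i) • v (i.succAbove j)))) A
          else 0

/-- The model for `⊕_{k=0}^K S^k ℝ^m ⊗ Hom(V₁,V₂)`. -/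
abbrev SymbT (K : ℕ) := ∀ k : Fin (K+1), Symb m V₁ V₂ (k : ℕ)

/-- The degree-wise representation `⊕_k σ^{(k)}` on `⊕_{k=0}^K S^k ℝ^m ⊗ Hom(V₁,V₂)`. -/
def sigmaT {K : ℕ} (B : GLm m) (T : SymbT m V₁ V₂ K) : SymbT m V₁ V₂ K :=
  fun k => sigmaS m V₁ V₂ σ₁ σ₂ B (T k)

/-- The extension of a family `γ` to `⊕_{k=0}^K S^k ℝ^m ⊗ Hom(V₁,V₂)` (lowering degree). -/
def gTot {K : ℕ} (γf : ∀ k : ℕ, Dualm m → (Symb m V₁ V₂ (k+1) →ₗ[ℝ] Symb m V₁ V₂ k))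
    (h : Dualm m) (T : SymbT m V₁ V₂ K) : SymbT m V₁ V₂ K :=
  fun k => if hk : (k : ℕ) + 1 < K + 1 then γf (k : ℕ) h (T ⟨(k : ℕ) + 1, hk⟩) else 0


/-- The action `ρ^{(k)}(a) = S^k a ⊗ (Φ ↦ ρ₂(a)∘Φ∘ρ₁(a)⁻¹)` of `GL(m,ℝ)` on
`S^k ℝ^m ⊗ Hom(V₁,V₂)`, in the model. -/
def rhoK {k : ℕ} (a : (Fin m → ℝ) ≃L[ℝ] (Fin m → ℝ)) (r₁ : V₁ ≃L[ℝ] V₁) (r₂ : V₂ ≃L[ℝ] V₂)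
    (T : Symb m V₁ V₂ k) : Symb m V₁ V₂ k :=
  ((ContinuousLinearMap.compL ℝ V₁ V₂ V₂ (r₂ : V₂ →L[ℝ] V₂)) ∘L
    ((ContinuousLinearMap.compL ℝ V₁ V₁ V₂).flip
      ((r₁.symm : V₁ →L[ℝ] V₁)))).compContinuousMultilinearMap
    (T.compContinuousLinearMap
      (fun _ => (ContinuousLinearMap.compL ℝ (Rm m) (Rm m) ℝ).flip
        (a : (Fin m → ℝ) →L[ℝ] (Fin m → ℝ))))

end Symbols

section Matrices

variable (m : ℕ)

/-- The element of `𝔤₁ ⊂ sl(m+1,ℝ)` with `ξ`-block the covector `h`. -/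
def hMat (h : Dualm m) : Matrix (Idx m) (Idx m) ℝ :=
  Matrix.fromBlocks 0 0 (Matrix.of fun _ j => h (Pi.single j 1)) 0

/-- The element of `𝔤₋₁ ⊂ sl(m+1,ℝ)` with `v`-block the vector `X`. -/
def XMat (X : Rm m) : Matrix (Idx m) (Idx m) ℝ :=
  Matrix.fromBlocks 0 (Matrix.of fun i _ => X i) 0 0

/-- The lift `B̃ ∈ 𝔤₀ ⊂ sl(m+1,ℝ)` of `B ∈ gl(m,ℝ)`, with `ψ(B̃) = B`. -/
def BTilde (B : GLm m) : Matrix (Idx m) (Idx m) ℝ :=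
  Matrix.fromBlocks
    (LinearMap.toMatrix' (B : (Fin m → ℝ) →ₗ[ℝ] (Fin m → ℝ))
      - ((LinearMap.trace ℝ (Rm m) (B : (Fin m → ℝ) →ₗ[ℝ] (Fin m → ℝ))) / ((m : ℝ) + 1)) • 1)
    0 0
    (Matrix.of fun _ _ => -(LinearMap.trace ℝ (Rm m) (B : (Fin m → ℝ) →ₗ[ℝ] (Fin m → ℝ))) / ((m : ℝ) + 1))

/-- The map `ψ : 𝔤₀ → gl(m,ℝ) : [[A,0],[0,a]] ↦ A - a·Id`. -/
def psiC (M : Matrix (Idx m) (Idx m) ℝ) : GLm m :=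
  LinearMap.toContinuousLinearMap
    ((Matrix.of fun i j => M (Sum.inl i) (Sum.inl j)).mulVecLin
      - M (Sum.inr ()) (Sum.inr ()) • LinearMap.id)

/-- The basis `(eᵢ)` of `𝔤₋₁`, corresponding to the standard basis of `ℝ^m`. -/
def eMat (i : Fin m) : Matrix (Idx m) (Idx m) ℝ := XMat m (Pi.single i 1)

/-- The covector `εⁱ = (1/(2(m+1))) δⁱ ∈ ℝ^{m*}`. -/
def epsD (i : Fin m) : Dualm m := (1 / (2 * ((m : ℝ) + 1))) • coordD m i

/-- The basis `(εⁱ)` of `𝔤₁`, Killing-dual to `(eᵢ)`. -/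
def epsMat (i : Fin m) : Matrix (Idx m) (Idx m) ℝ := hMat m (epsD m i)

/-- The Euler element `E = diag(-1/(m+1), …, -1/(m+1), m/(m+1)) ∈ 𝔤₀`, with `ψ(E) = -Id`. -/
def EMat : Matrix (Idx m) (Idx m) ℝ :=
  Matrix.fromBlocks ((-(1 / ((m : ℝ) + 1))) • 1) 0 0 (Matrix.of fun _ _ => (m : ℝ) / ((m : ℝ) + 1))

/-- Membership in `𝔰 ≅ sl(m,ℝ) ⊂ 𝔤₀`: block diagonal with vanishing corner and traceless. -/
def inS (M : Matrix (Idx m) (Idx m) ℝ) : Prop :=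
  (∀ i, M (Sum.inl i) (Sum.inr ()) = 0) ∧ (∀ j, M (Sum.inr ()) (Sum.inl j) = 0) ∧
    M (Sum.inr ()) (Sum.inr ()) = 0 ∧ Matrix.trace M = 0

/-- Membership in `𝔤₋₁`: only the `v`-block is nonzero. -/
def inGm1 (M : Matrix (Idx m) (Idx m) ℝ) : Prop :=
  (∀ i j, M (Sum.inl i) (Sum.inl j) = 0) ∧ (∀ j, M (Sum.inr ()) (Sum.inl j) = 0) ∧
    M (Sum.inr ()) (Sum.inr ()) = 0

/-- Membership in `𝔤₁`: only the `ξ`-block is nonzero. -/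
def inG1 (M : Matrix (Idx m) (Idx m) ℝ) : Prop :=
  (∀ i j, M (Sum.inl i) (Sum.inl j) = 0) ∧ (∀ i, M (Sum.inl i) (Sum.inr ()) = 0) ∧
    M (Sum.inr ()) (Sum.inr ()) = 0

/-- Membership in `𝔤₀`: block diagonal. -/
def inG0 (M : Matrix (Idx m) (Idx m) ℝ) : Prop :=
  (∀ i, M (Sum.inl i) (Sum.inr ()) = 0) ∧ (∀ j, M (Sum.inr ()) (Sum.inl j) = 0)

/-- The Killing form of `sl(m+1,ℝ)`: `κ(M,N) = 2(m+1) tr(MN)`. -/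
def kappa (M N : Matrix (Idx m) (Idx m) ℝ) : ℝ := 2 * ((m : ℝ) + 1) * Matrix.trace (M * N)

end Matrices

section SymbolOperators

variable (m : ℕ) (V₁ V₂ : Type)
  [NormedAddCommGroup V₁] [NormedSpace ℝ V₁] [NormedAddCommGroup V₂] [NormedSpace ℝ V₂]
  (σ₁ : GLm m →ₗ[ℝ] (V₁ →L[ℝ] V₁)) (σ₂ : GLm m →ₗ[ℝ] (V₂ →L[ℝ] V₂))

/-- The operator `C₀ = (1/2)σ^{(k)}(Id) + (1/2m)σ^{(k)}(Id)² + Σ_s σ^{(k)}(ψ(h_s))∘σ^{(k)}(ψ(h_s^*))`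
on `S^k ℝ^m ⊗ Hom(V₁,V₂)`. -/
def C0op {k : ℕ} {n : ℕ} (hs hs' : Fin n → Matrix (Idx m) (Idx m) ℝ)
    (T : Symb m V₁ V₂ k) : Symb m V₁ V₂ k :=
  (1/2 : ℝ) • sigmaS m V₁ V₂ σ₁ σ₂ (ContinuousLinearMap.id ℝ (Rm m)) T
  + (1/(2*(m : ℝ))) • sigmaS m V₁ V₂ σ₁ σ₂ (ContinuousLinearMap.id ℝ (Rm m))
      (sigmaS m V₁ V₂ σ₁ σ₂ (ContinuousLinearMap.id ℝ (Rm m)) T)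
  + ∑ s, sigmaS m V₁ V₂ σ₁ σ₂ (psiC m (hs s)) (sigmaS m V₁ V₂ σ₁ σ₂ (psiC m (hs' s)) T)

/-- `C₀` acting degreewise on `⊕_{k=0}^K S^k ℝ^m ⊗ Hom(V₁,V₂)`. -/
def C0tot {K : ℕ} {n : ℕ} (hs hs' : Fin n → Matrix (Idx m) (Idx m) ℝ)
    (T : SymbT m V₁ V₂ K) : SymbT m V₁ V₂ K :=
  fun k => C0op m V₁ V₂ σ₁ σ₂ hs hs' (T k)

/-- The operator `𝓛_M = L_{X^M} + γ(ξ_M)` (flat curly Lie derivative) on functions with values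
in `⊕_{k=0}^K S^k ℝ^m ⊗ Hom(V₁,V₂)`, where `ξ_M` is the `𝔤₁`-component of `M`. -/
def curlyL {K : ℕ} (γf : ∀ k : ℕ, Dualm m → (Symb m V₁ V₂ (k+1) →ₗ[ℝ] Symb m V₁ V₂ k))
    (M : Matrix (Idx m) (Idx m) ℝ) (f : Rm m → SymbT m V₁ V₂ K) : Rm m → SymbT m V₁ V₂ K :=
  fun x => lieD m (fun B T => sigmaT m V₁ V₂ σ₁ σ₂ B T) (projVF m M) f x
    + gTot m V₁ V₂ γf (∑ j, M (Sum.inr ()) (Sum.inl j) • coordD m j) (f x)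

end SymbolOperators

section Curved

variable (m : ℕ) (P : Type) [NormedAddCommGroup P] [NormedSpace ℝ P]

/-- The invariant derivative `L_{ω^{-1}(Z)} f` along the `ω`-constant vector field `η Z`. -/
def LD (η : Matrix (Idx m) (Idx m) ℝ → P → P) (Z : Matrix (Idx m) (Idx m) ℝ)
    {V : Type} [NormedAddCommGroup V] [NormedSpace ℝ V] (f : P → V) : P → V :=
  fun u => fderiv ℝ f u (η Z u)

/-- The bracket compatibility satisfied by a normal Cartan connection: for `M ∈ 𝔤₀ ⊕ 𝔤₁` and
`N ∈ 𝔤₋₁`, `L_{ω^{-1}(M)} ∘ L_{ω^{-1}(N)} - L_{ω^{-1}(N)} ∘ L_{ω^{-1}(M)} = L_{ω^{-1}([M,N])}` on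
smooth vector-space-valued functions. -/
def BracketCompat (η : Matrix (Idx m) (Idx m) ℝ → P → P) : Prop :=
  ∀ (V : Type) [NormedAddCommGroup V] [NormedSpace ℝ V],
    ∀ f : P → V, ContDiff ℝ (⊤ : ℕ∞) f →
      ∀ M N : Matrix (Idx m) (Idx m) ℝ, Matrix.trace M = 0 → Matrix.trace N = 0 →
        (∀ i, M (Sum.inl i) (Sum.inr ()) = 0) → inGm1 m N →
        (LD m P η M (LD m P η N f) - LD m P η N (LD m P η M f)) = LD m P η (M * N - N * M) f

/-- Infinitesimal `G₀`-equivariance of `f : P → V` with respect to `σ`: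
`L_{ω^{-1}(B̃)} f = -σ(B) f` for all `B ∈ gl(m,ℝ)`. -/
def equivG0 (η : Matrix (Idx m) (Idx m) ℝ → P → P)
    {V : Type} [NormedAddCommGroup V] [NormedSpace ℝ V]
    (σ : GLm m → V → V) (f : P → V) : Prop :=
  ∀ B : GLm m, LD m P η (BTilde m B) f = fun u => -(σ B (f u))

/-- Iterated invariant derivatives along `𝔤₋₁`-constant fields. -/
def iterL (η : Matrix (Idx m) (Idx m) ℝ → P → P)
    {V : Type} [NormedAddCommGroup V] [NormedSpace ℝ V] :
    (k : ℕ) → (Fin k → Rm m) → (P → V) → (P → V)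
  | 0, _, f => f
  | (k+1), v, f => LD m P η (XMat m (v 0)) (iterL η k (fun j => v j.succ) f)

/-- The symmetrized iterated invariant differential `(∇^ω)^k f`, evaluated on
`(X₁, …, X_k) ∈ (ℝ^m)^k`. -/
def nabK (η : Matrix (Idx m) (Idx m) ℝ → P → P)
    {V : Type} [NormedAddCommGroup V] [NormedSpace ℝ V]
    (k : ℕ) (f : P → V) (v : Fin k → Rm m) : P → V :=
  fun u => (k.factorial : ℝ)⁻¹ • ∑ ν : Equiv.Perm (Fin k), iterL m P η k (v ∘ ν) f u

variable (V₁ V₂ : Type)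
  [NormedAddCommGroup V₁] [NormedSpace ℝ V₁] [NormedAddCommGroup V₂] [NormedSpace ℝ V₂]

/-- The curved quantization map: `Q_ω(T)(f)(u) = ⟨T(u), (∇^ω)^k f(u)⟩` (full contraction). -/
def Qom (η : Matrix (Idx m) (Idx m) ℝ → P → P) {k : ℕ}
    (T : P → Symb m V₁ V₂ k) (f : P → V₁) : P → V₂ :=
  fun u => (k.factorial : ℝ)⁻¹ • ∑ d : Fin k → Fin m,
    (T u (fun t => coordD m (d t))) (nabK m P η k f (fun t => Pi.single (d t) 1) u)


/-- The curved operator `N^ω f = -2 Σᵢ γ(εⁱ)(L_{ω^{-1}(eᵢ)} f)`. -/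
def Nom {K : ℕ} (γf : ∀ k : ℕ, Dualm m → (Symb m V₁ V₂ (k+1) →ₗ[ℝ] Symb m V₁ V₂ k))
    (η : Matrix (Idx m) (Idx m) ℝ → P → P) (f : P → SymbT m V₁ V₂ K) : P → SymbT m V₁ V₂ K :=
  fun u => (-2 : ℝ) • ∑ i : Fin m, gTot m V₁ V₂ γf (epsD m i)
    (LD m P η (XMat m (Pi.single i 1)) f u)

end Curved


/-! ### Polarization of symbols -/

theorem sum_neg_one_pow_card_of_forall_mem {ι : Type*} [Fintype ι] [DecidableEq ι] (g : ι → ι) :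
    ∑ s : Finset ι, (if ∀ t, g t ∈ s then (-1 : ℝ) ^ s.card else 0)
      = if Function.Bijective g then (-1) ^ Fintype.card ι else 0 := by
  split_ifs with hg
  · rw [Finset.sum_eq_single Finset.univ]
    · simp
    · intro s _ hs
      refine if_neg fun h => hs (Finset.eq_univ_of_forall fun i => ?_)
      obtain ⟨t, rfl⟩ := hg.2 i
      exact h t
    · simp
  · obtain ⟨i, hi⟩ : ∃ i, ∀ t, g t ≠ i := by
      by_contra! h
      exact hg (Finite.surjective_iff_bijective.1 h)
    refine Finset.sum_involution
      (fun s _ => if i ∈ s then s.erase i else insert i s) ?_ ?_ ?_ ?_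
    · intro s _
      by_cases his : i ∈ s
      · have : (∀ t, g t ∈ s.erase i) ↔ ∀ t, g t ∈ s := by simp [hi]
        have hc := Finset.card_erase_add_one his
        simp only [his, if_true, this, ← hc, pow_succ]
        split_ifs <;> ring
      · have : (∀ t, g t ∈ insert i s) ↔ ∀ t, g t ∈ s := by simp [hi]
        simp only [his, if_false, this, Finset.card_insert_of_notMem his, pow_succ]
        split_ifs <;> ring
    · intro s _ _ h
      by_cases his : i ∈ s
      · rw [if_pos his] at h
        exact Finset.erase_eq_self.1 h his
      · rw [if_neg his] at h
        exact his (Finset.insert_eq_self.1 h)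
    · simp
    · intro s _
      by_cases his : i ∈ s <;> simp [his]

/-- Ryser's formula for the permanent. -/
theorem sum_perm_prod_eq_sum_finset {ι : Type*} [Fintype ι] [DecidableEq ι] (a : ι → ι → ℝ) :
    ∑ ν : Equiv.Perm ι, ∏ t, a t (ν t)
      = ∑ s : Finset ι, (-1) ^ (Fintype.card ι + s.card) * ∏ t, ∑ i ∈ s, a t i := by
  have key (s : Finset ι) : (-1 : ℝ) ^ (Fintype.card ι + s.card) * ∏ t, ∑ i ∈ s, a t i
      = ∑ g : ι → ι, (-1) ^ Fintype.card ι *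
        ((if ∀ t, g t ∈ s then (-1 : ℝ) ^ s.card else 0) * ∏ t, a t (g t)) := by
    rw [Finset.prod_univ_sum, Finset.mul_sum]
    have hs : Fintype.piFinset (fun _ : ι => s)
        = Finset.univ.filter (fun g : ι → ι => ∀ t, g t ∈ s) := by
      ext g; simp
    rw [hs, Finset.sum_filter]
    refine Finset.sum_congr rfl fun g _ => ?_
    split_ifs
    · ring
    · simp
  simp_rw [key]
  rw [Finset.sum_comm]
  simp_rw [← Finset.mul_sum, ← Finset.sum_mul, sum_neg_one_pow_card_of_forall_mem, ite_mul,
    zero_mul]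
  rw [← Finset.sum_filter, ← Finset.mul_sum, ← mul_assoc, ← pow_add, Even.neg_one_pow ⟨_, rfl⟩,
    one_mul]
  refine Finset.sum_bij' (fun ν _ => (ν : ι → ι))
    (fun g hg => Equiv.ofBijective g (Finset.mem_filter.1 hg).2) ?_ ?_ ?_ ?_ ?_
  · simp
  · simp
  · intro ν _; ext; simp
  · intro g _; rfl
  · intro ν _; rfl

section Symbols

variable {m : ℕ} {V₁ V₂ : Type}
  [NormedAddCommGroup V₁] [NormedSpace ℝ V₁] [NormedAddCommGroup V₂] [NormedSpace ℝ V₂]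

theorem pureT_apply {k : ℕ} (v : Fin k → Rm m) (A : V₁ →L[ℝ] V₂) (φ : Fin k → Dualm m) :
    pureT m V₁ V₂ v A φ = (∏ t, φ t (v t)) • A := by
  simp [pureT]

theorem symT_const {k : ℕ} (x : Rm m) (A : V₁ →L[ℝ] V₂) :
    symT m V₁ V₂ (fun _ : Fin k => x) A
      = (k.factorial : ℝ) • pureT m V₁ V₂ (fun _ => x) A := by
  have : ∀ ν : Equiv.Perm (Fin k), (fun _ : Fin k => x) ∘ ν = fun _ => x := fun _ => rfl
  simp [symT, this, Finset.card_univ, Fintype.card_perm, ← Nat.cast_smul_eq_nsmul ℝ]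

theorem symT_eq_sum_pureT_const {k : ℕ} (v : Fin k → Rm m) (A : V₁ →L[ℝ] V₂) :
    symT m V₁ V₂ v A = ∑ s : Finset (Fin k),
      ((-1 : ℝ) ^ (k + s.card)) • pureT m V₁ V₂ (fun _ => ∑ i ∈ s, v i) A := by
  ext1 φ
  have := sum_perm_prod_eq_sum_finset (fun t i => φ t (v i))
  rw [Fintype.card_fin] at this
  simp only [symT, sum_apply, smul_apply,
    pureT_apply, smul_smul, Function.comp_apply, map_sum, ← Finset.sum_smul, this]

/-- By polarization, the symbols are spanned by the symmetric powers. -/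
theorem spanGen_le_span_symT_const (k : ℕ) :
    spanGen m V₁ V₂ k ≤ Submodule.span ℝ
      {T | ∃ (x : Rm m) (A : V₁ →L[ℝ] V₂), T = symT m V₁ V₂ (fun _ => x) A} := by
  refine Submodule.span_le.2 ?_
  rintro _ ⟨v, A, rfl⟩
  rw [SetLike.mem_coe, symT_eq_sum_pureT_const]
  refine Submodule.sum_mem _ fun s _ => Submodule.smul_mem _ _ ?_
  have hk : (k.factorial : ℝ) ≠ 0 := by positivity
  rw [← inv_smul_smul₀ hk (pureT m V₁ V₂ _ A), ← symT_const]
  exact Submodule.smul_mem _ _ (Submodule.subset_span ⟨_, A, rfl⟩)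

theorem symT_const_smul_update {k : ℕ} (x : Rm m) (c : ℝ) (j : Fin k) (A : V₁ →L[ℝ] V₂) :
    symT m V₁ V₂ (Function.update (fun _ => x) j (c • x)) A
      = c • symT m V₁ V₂ (fun _ => x) A := by
  ext1 φ
  simp only [symT, sum_apply, smul_apply,
    pureT_apply, smul_smul, ← Finset.sum_smul, Finset.mul_sum]
  congr 1
  refine Finset.sum_congr rfl fun ν _ => ?_
  have hφ : ∀ t, φ t ((Function.update (fun _ : Fin k => x) j (c • x) ∘ ν) t)
      = (if t = ν.symm j then c else 1) * φ t x := by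
    intro t
    by_cases ht : t = ν.symm j
    · subst ht; simp
    · have : ν t ≠ j := fun h => ht (by rw [← h]; simp)
      simp [ht, this]
  simp_rw [hφ, Finset.prod_mul_distrib]
  simp

theorem gammaProp.symT_const {σ₁ : GLm m →ₗ[ℝ] (V₁ →L[ℝ] V₁)} {k : ℕ}
    {γ : Dualm m → (Symb m V₁ V₂ (k+1) →ₗ[ℝ] Symb m V₁ V₂ k)} (hγ : gammaProp m V₁ V₂ σ₁ γ)
    (h : Dualm m) (x : Rm m) (A : V₁ →L[ℝ] V₂) :
    γ h (symT m V₁ V₂ (fun _ => x) A) =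
      ((k : ℝ) + 1) • symT m V₁ V₂ (fun _ => x)
          (A.comp (σ₁ (rkOne m x h + h x • ContinuousLinearMap.id ℝ (Rm m))))
        - (((k : ℝ) + 1) * k * h x) • symT m V₁ V₂ (fun _ => x) A := by
  rw [hγ]
  have hrem (i : Fin (k+1)) : i.removeNth (fun _ : Fin (k+1) => x) = fun _ => x := rfl
  have hupd (i : Fin (k+1)) (j : Fin k) :
      i.removeNth (Function.update (fun _ : Fin (k+1) => x) (i.succAbove j) (h x • x + h x • x))
        = Function.update (fun _ => x) j ((2 * h x) • x) := by
    rw [Fin.removeNth_update_succAbove, hrem, ← add_smul, two_mul]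
  have hcard (i : Fin (k+1)) :
      (Finset.univ.filter fun j : Fin k => (i.succAbove j : ℕ) < (i : ℕ)).card = i := by
    have : (Finset.univ.filter fun j : Fin k => (i.succAbove j : ℕ) < (i : ℕ))
        = Finset.univ.filter fun j : Fin k => (j : ℕ) < i := by
      ext j
      simp only [Finset.mem_filter, Finset.mem_univ, true_and, Fin.succAbove, Fin.lt_def]
      split_ifs with hj <;> simp at hj ⊢
      omega
    rw [this, Fin.card_filter_val_lt]
    omega
  have hsum : ∑ i : Fin (k+1), ((i : ℕ) : ℝ) * 2 = ((k : ℝ) + 1) * k := by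
    rw [Fin.sum_univ_eq_sum_range (fun i => (i : ℝ) * 2), ← Finset.sum_mul]
    have := Finset.sum_range_id_mul_two (k+1)
    have h2 := congrArg (Nat.cast (R := ℝ)) this
    push_cast at h2
    simpa using h2
  simp_rw [hrem, hupd, symT_const_smul_update, ← Finset.sum_filter, Finset.sum_const, hcard,
    ← Nat.cast_smul_eq_nsmul ℝ, smul_smul, ← Finset.sum_smul, ← hsum, ← mul_assoc,
    ← Finset.sum_mul]
  simp

theorem sum_perm_prod_smul_comp {k : ℕ} (x : Rm m) (A : V₁ →L[ℝ] V₂)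
    (H : (Fin k → Fin m) → V₁) :
    (k.factorial : ℝ)⁻¹ • ∑ d : Fin k → Fin m,
      (symT m V₁ V₂ (fun _ => x) A (fun t => coordD m (d t)))
        ((k.factorial : ℝ)⁻¹ • ∑ ν : Equiv.Perm (Fin k), H (d ∘ ν))
      = A (∑ d : Fin k → Fin m, (∏ t, x (d t)) • H d) := by
  have hk : (k.factorial : ℝ) ≠ 0 := by positivity
  have hν (ν : Equiv.Perm (Fin k)) : ∑ d : Fin k → Fin m, (∏ t, x (d t)) • A (H (d ∘ ν))
      = ∑ d : Fin k → Fin m, (∏ t, x (d t)) • A (H d) := by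
    refine Fintype.sum_equiv (ν.symm.arrowCongr (Equiv.refl _)) _ _ fun d => ?_
    have hp : ∏ t, x (d (ν t)) = ∏ t, x (d t) := Equiv.prod_comp ν fun t => x (d t)
    simp only [Equiv.arrowCongr_apply, Equiv.symm_symm, Equiv.coe_refl, Function.comp_apply, id_eq,
      hp]
    rfl
  have hterm (d : Fin k → Fin m) :
      (symT m V₁ V₂ (fun _ => x) A (fun t => coordD m (d t)))
        ((k.factorial : ℝ)⁻¹ • ∑ ν : Equiv.Perm (Fin k), H (d ∘ ν))
      = ∑ ν : Equiv.Perm (Fin k), (∏ t, x (d t)) • A (H (d ∘ ν)) := by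
    rw [ProjQuant.symT_const, smul_apply, pureT_apply,
      smul_apply, map_smul, smul_inv_smul₀ hk,
      smul_apply, map_sum, Finset.smul_sum]
    rfl
  simp_rw [hterm]
  rw [Finset.sum_comm]
  simp_rw [hν]
  rw [Finset.sum_const, Finset.card_univ, Fintype.card_perm, Fintype.card_fin,
    ← Nat.cast_smul_eq_nsmul ℝ, inv_smul_smul₀ hk, map_sum]
  simp

end Symbols

/-! ### Invariant derivatives -/

section Curved

variable {m : ℕ} {P : Type} [NormedAddCommGroup P] [NormedSpace ℝ P]
  {η : Matrix (Idx m) (Idx m) ℝ → P → P}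
  {V W : Type} [NormedAddCommGroup V] [NormedSpace ℝ V] [NormedAddCommGroup W] [NormedSpace ℝ W]

theorem contDiff_LD (hη : ∀ Z, ContDiff ℝ (⊤ : ℕ∞) (η Z)) (Z : Matrix (Idx m) (Idx m) ℝ)
    {f : P → V} (hf : ContDiff ℝ (⊤ : ℕ∞) f) : ContDiff ℝ (⊤ : ℕ∞) (LD m P η Z f) :=
  (hf.fderiv_right (by simp)).clm_apply (hη Z)

theorem contDiff_iterL (hη : ∀ Z, ContDiff ℝ (⊤ : ℕ∞) (η Z)) {f : P → V}
    (hf : ContDiff ℝ (⊤ : ℕ∞) f) :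
    ∀ (k : ℕ) (v : Fin k → Rm m), ContDiff ℝ (⊤ : ℕ∞) (iterL m P η k v f)
  | 0, _ => hf
  | k+1, _ => contDiff_LD hη _ (contDiff_iterL hη hf k _)

theorem LD_add (Z : Matrix (Idx m) (Idx m) ℝ) {f g : P → V} (hf : Differentiable ℝ f)
    (hg : Differentiable ℝ g) : LD m P η Z (f + g) = LD m P η Z f + LD m P η Z g := by
  ext u; simp [LD, fderiv_add (hf u) (hg u)]

theorem LD_const_smul (Z : Matrix (Idx m) (Idx m) ℝ) (c : ℝ) (f : P → V) :
    LD m P η Z (c • f) = c • LD m P η Z f := by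
  ext u; simp [LD, fderiv_const_smul_field]

theorem LD_sum {ι : Type*} (s : Finset ι) (Z : Matrix (Idx m) (Idx m) ℝ) {f : ι → P → V}
    (hf : ∀ i, Differentiable ℝ (f i)) :
    LD m P η Z (∑ i ∈ s, f i) = ∑ i ∈ s, LD m P η Z (f i) := by
  ext u; simp [LD, fderiv_sum fun i _ => hf i u, Finset.sum_apply]

theorem LD_clm_comp (Z : Matrix (Idx m) (Idx m) ℝ) (C : V →L[ℝ] W) {f : P → V}
    (hf : Differentiable ℝ f) :
    LD m P η Z (fun u => C (f u)) = fun u => C (LD m P η Z f u) := by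
  ext u
  have := (C.hasFDerivAt.comp u (hf u).hasFDerivAt).fderiv
  simp only [LD]
  erw [this]
  rfl

theorem iterL_clm_comp (hη : ∀ Z, ContDiff ℝ (⊤ : ℕ∞) (η Z)) (C : V →L[ℝ] W) {f : P → V}
    (hf : ContDiff ℝ (⊤ : ℕ∞) f) : ∀ (k : ℕ) (v : Fin k → Rm m),
    iterL m P η k v (fun u => C (f u)) = fun u => C (iterL m P η k v f u)
  | 0, _ => rfl
  | k+1, v => by
    simp only [iterL]
    rw [iterL_clm_comp hη C hf k,
      LD_clm_comp _ C ((contDiff_iterL hη hf k _).differentiable (by simp))]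

/-- `ω`-constant vector fields depend linearly on the Lie algebra element. -/
def constVF (hηadd : ∀ Z Z' u, η (Z + Z') u = η Z u + η Z' u)
    (hηsmul : ∀ (c : ℝ) Z u, η (c • Z) u = c • η Z u) (u : P) :
    Matrix (Idx m) (Idx m) ℝ →ₗ[ℝ] P where
  toFun Z := η Z u
  map_add' Z Z' := hηadd Z Z' u
  map_smul' c Z := hηsmul c Z u

theorem XMat_eq_sum (x : Rm m) : XMat m x = ∑ i, x i • XMat m (Pi.single i 1) := by
  ext a b
  rw [Matrix.sum_apply]
  rcases a with a | a <;> rcases b with b | b <;> simp [XMat, Pi.single_apply]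

theorem LD_XMat (hηadd : ∀ Z Z' u, η (Z + Z') u = η Z u + η Z' u)
    (hηsmul : ∀ (c : ℝ) Z u, η (c • Z) u = c • η Z u) (x : Rm m) (f : P → V) :
    LD m P η (XMat m x) f = ∑ i, x i • LD m P η (XMat m (Pi.single i 1)) f := by
  ext u
  have : η (XMat m x) u = ∑ i, x i • η (XMat m (Pi.single i 1)) u := by
    change constVF hηadd hηsmul u (XMat m x) = _
    rw [XMat_eq_sum, map_sum]
    simp only [map_smul]
    rfl
  simp [LD, this, Finset.sum_apply]

theorem iterL_const_eq_sum (hη : ∀ Z, ContDiff ℝ (⊤ : ℕ∞) (η Z))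
    (hηadd : ∀ Z Z' u, η (Z + Z') u = η Z u + η Z' u)
    (hηsmul : ∀ (c : ℝ) Z u, η (c • Z) u = c • η Z u) (x : Rm m) {f : P → V}
    (hf : ContDiff ℝ (⊤ : ℕ∞) f) : ∀ k : ℕ, iterL m P η k (fun _ => x) f
      = ∑ d : Fin k → Fin m, (∏ t, x (d t)) • iterL m P η k (fun t => Pi.single (d t) 1) f
  | 0 => by simp [iterL]
  | k+1 => by
    have hd (d : Fin k → Fin m) : Differentiable ℝ
        ((∏ t, x (d t)) • iterL m P η k (fun t => Pi.single (d t) 1) f) :=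
      ((contDiff_iterL hη hf k _).differentiable (by simp)).const_smul _
    rw [iterL, iterL_const_eq_sum hη hηadd hηsmul x hf k, LD_XMat hηadd hηsmul,
      ← (Fin.consEquiv fun _ : Fin (k+1) => Fin m).sum_comp, Fintype.sum_prod_type]
    refine Finset.sum_congr rfl fun i _ => ?_
    rw [LD_sum _ _ hd, Finset.smul_sum]
    refine Finset.sum_congr rfl fun d _ => ?_
    rw [LD_const_smul, smul_smul, Fin.prod_univ_succ]
    simp [Fin.consEquiv, iterL]

theorem hMat_mul_XMat_sub (h : Dualm m) (x : Rm m) :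
    hMat m h * XMat m x - XMat m x * hMat m h
      = BTilde m (-(rkOne m x h + h x • ContinuousLinearMap.id ℝ (Rm m))) := by
  have hsum : ∑ j, h (Pi.single j 1) * x j = h x := by
    conv_rhs => rw [← Finset.univ_sum_single x, map_sum]
    refine Finset.sum_congr rfl fun j _ => ?_
    rw [mul_comm, ← smul_eq_mul, ← map_smul, ← Pi.single_smul]
    simp
  have htr : LinearMap.trace ℝ (Rm m)
      ((-(rkOne m x h + h x • ContinuousLinearMap.id ℝ (Rm m)) : GLm m) : Rm m →ₗ[ℝ] Rm m)
      = -((m : ℝ) + 1) * h x := by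
    rw [LinearMap.trace_eq_matrix_trace ℝ (Pi.basisFun ℝ (Fin m))]
    simp only [Matrix.trace, Matrix.diag, LinearMap.toMatrix_apply]
    simp [rkOne, Finset.sum_add_distrib, hsum]
    ring
  have hm : (m : ℝ) + 1 ≠ 0 := by positivity
  unfold BTilde
  rw [htr, hMat, XMat, Matrix.fromBlocks_multiply, Matrix.fromBlocks_multiply]
  ext a b
  rcases a with a | a <;> rcases b with b | b <;>
    simp [Matrix.mul_apply, LinearMap.toMatrix'_apply, rkOne, Matrix.one_apply, hsum]
  · split_ifs <;> field_simp <;> ring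
  · field_simp
    ring

theorem BTilde_mul_XMat_sub (B : GLm m) (x : Rm m) :
    BTilde m B * XMat m x - XMat m x * BTilde m B = XMat m (B x) := by
  have hB (a : Fin m) :
      ∑ j, LinearMap.toMatrix' (B : Rm m →ₗ[ℝ] Rm m) a j * x j = B x a := by
    have := congrFun (LinearMap.toMatrix'_mulVec (B : Rm m →ₗ[ℝ] Rm m) x) a
    simpa [Matrix.mulVec, dotProduct] using this
  rw [BTilde, XMat, XMat, Matrix.fromBlocks_multiply, Matrix.fromBlocks_multiply]
  ext a b
  rcases a with a | a <;> rcases b with b | b <;>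
    simp [Matrix.mul_apply, Matrix.sub_mul, -LinearMap.toMatrix'_apply, hB]
  ring

theorem trace_BTilde (B : GLm m) : (BTilde m B).trace = 0 := by
  have hm : (m : ℝ) + 1 ≠ 0 := by positivity
  have ht := LinearMap.trace_eq_matrix_trace ℝ (Pi.basisFun ℝ (Fin m)) (B : Rm m →ₗ[ℝ] Rm m)
  rw [LinearMap.toMatrix_eq_toMatrix', Matrix.trace] at ht
  simp only [BTilde, Matrix.trace, Matrix.diag, Fintype.sum_sum_type, Matrix.fromBlocks_apply₁₁,
    Matrix.fromBlocks_apply₂₂, Matrix.sub_apply, Finset.sum_sub_distrib]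
  simp only [Matrix.diag] at ht
  rw [← ht]
  simp
  field_simp
  ring

theorem inGm1_XMat (x : Rm m) : inGm1 m (XMat m x) := by
  simp [inGm1, XMat]

theorem trace_XMat (x : Rm m) : (XMat m x).trace = 0 := by
  simp [XMat, Matrix.trace]

theorem trace_hMat (h : Dualm m) : (hMat m h).trace = 0 := by
  simp [hMat, Matrix.trace]

theorem BracketCompat.LD_BTilde_XMat (hbr : BracketCompat m P η)
    {f : P → V} (hf : ContDiff ℝ (⊤ : ℕ∞) f) (B : GLm m) (x : Rm m) :
    LD m P η (BTilde m B) (LD m P η (XMat m x) f)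
      = LD m P η (XMat m x) (LD m P η (BTilde m B) f) + LD m P η (XMat m (B x)) f := by
  rw [← BTilde_mul_XMat_sub, ← hbr V f hf _ _ (trace_BTilde B) (trace_XMat x)
    (by simp [BTilde]) (inGm1_XMat x)]
  abel

theorem BracketCompat.LD_hMat_XMat (hbr : BracketCompat m P η)
    {f : P → V} (hf : ContDiff ℝ (⊤ : ℕ∞) f) (h : Dualm m) (x : Rm m) :
    LD m P η (hMat m h) (LD m P η (XMat m x) f)
      = LD m P η (XMat m x) (LD m P η (hMat m h) f)
        + LD m P η (BTilde m (-(rkOne m x h + h x • ContinuousLinearMap.id ℝ (Rm m)))) f := by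
  rw [← hMat_mul_XMat_sub, ← hbr V f hf _ _ (trace_hMat h) (trace_XMat x)
    (by simp [hMat]) (inGm1_XMat x)]
  abel

theorem LD_BTilde_iterL_const (hη : ∀ Z, ContDiff ℝ (⊤ : ℕ∞) (η Z))
    (hηadd : ∀ Z Z' u, η (Z + Z') u = η Z u + η Z' u)
    (hηsmul : ∀ (c : ℝ) Z u, η (c • Z) u = c • η Z u)
    (hbr : BracketCompat m P η) {σ : GLm m →ₗ[ℝ] (V →L[ℝ] V)} {f : P → V}
    (hf : ContDiff ℝ (⊤ : ℕ∞) f) (hfeq : equivG0 m P η (fun B u => σ B u) f)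
    {B : GLm m} {x : Rm m} {c : ℝ} (hB : B x = c • x) : ∀ k : ℕ,
    LD m P η (BTilde m B) (iterL m P η k (fun _ => x) f)
      = (fun u => σ (-B) (iterL m P η k (fun _ => x) f u))
        + ((k : ℝ) * c) • iterL m P η k (fun _ => x) f
  | 0 => by
    simp only [iterL]
    rw [hfeq B]
    ext u; simp
  | k+1 => by
    have hs := contDiff_iterL hη hf k (fun _ => x)
    have hd : Differentiable ℝ (iterL m P η k (fun _ => x) f) := hs.differentiable (by simp)
    have hx : LD m P η (XMat m (B x)) (iterL m P η k (fun _ => x) f)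
        = c • LD m P η (XMat m x) (iterL m P η k (fun _ => x) f) := by
      rw [hB, LD_XMat hηadd hηsmul, LD_XMat hηadd hηsmul x, Finset.smul_sum]
      simp [smul_smul]
    have hσ : Differentiable ℝ (fun u => σ (-B) (iterL m P η k (fun _ => x) f u)) :=
      (σ (-B)).differentiable.comp hd
    simp only [iterL]
    rw [hbr.LD_BTilde_XMat hs, LD_BTilde_iterL_const hη hηadd hηsmul hbr hf hfeq hB k,
      LD_add _ hσ (hd.const_smul _), LD_const_smul,
      LD_clm_comp _ _ hd, hx]
    push_cast
    module

theorem LD_hMat_iterL_const (hη : ∀ Z, ContDiff ℝ (⊤ : ℕ∞) (η Z))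
    (hηadd : ∀ Z Z' u, η (Z + Z') u = η Z u + η Z' u)
    (hηsmul : ∀ (c : ℝ) Z u, η (c • Z) u = c • η Z u)
    (hbr : BracketCompat m P η) {σ : GLm m →ₗ[ℝ] (V →L[ℝ] V)} {f : P → V}
    (hf : ContDiff ℝ (⊤ : ℕ∞) f) (hfeq : equivG0 m P η (fun B u => σ B u) f)
    (h : Dualm m) (x : Rm m) : ∀ k : ℕ,
    LD m P η (hMat m h) (iterL m P η (k+1) (fun _ => x) f)
      = iterL m P η (k+1) (fun _ => x) (LD m P η (hMat m h) f)
        + ((k : ℝ) + 1) • (fun u => σ (rkOne m x h + h x • ContinuousLinearMap.id ℝ (Rm m))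
            (iterL m P η k (fun _ => x) f u))
        - (((k : ℝ) + 1) * k * h x) • iterL m P η k (fun _ => x) f
  | 0 => by
    simp only [iterL]
    rw [hbr.LD_hMat_XMat hf, hfeq]
    ext u; simp
  | k+1 => by
    have hs := contDiff_iterL hη hf (k+1) (fun _ => x)
    have hs' := contDiff_iterL hη hf k (fun _ => x)
    have hd : Differentiable ℝ (iterL m P η k (fun _ => x) f) := hs'.differentiable (by simp)
    have hh : Differentiable ℝ (iterL m P η (k+1) (fun _ => x) (LD m P η (hMat m h) f)) :=
      (contDiff_iterL hη (contDiff_LD hη _ hf) (k+1) _).differentiable (by simp)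
    set S : GLm m := rkOne m x h + h x • ContinuousLinearMap.id ℝ (Rm m) with hS
    have hB : (-S) x = (-2 * h x) • x := by
      simp only [hS, rkOne, neg_apply, add_apply,
        ContinuousLinearMap.smulRight_apply, smul_apply,
        ContinuousLinearMap.id_apply]
      module
    have hD : LD m P η (XMat m x) (iterL m P η k (fun _ => x) f)
        = iterL m P η (k+1) (fun _ => x) f := rfl
    have hσ : Differentiable ℝ (fun u => σ S (iterL m P η k (fun _ => x) f u)) :=
      (σ S).differentiable.comp hd
    rw [iterL, hbr.LD_hMat_XMat hs, LD_BTilde_iterL_const hη hηadd hηsmul hbr hf hfeq hB (k+1),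
      LD_hMat_iterL_const hη hηadd hηsmul hbr hf hfeq h x k, sub_eq_add_neg, ← neg_smul,
      LD_add _ (hh.add (hσ.const_smul _)) (hd.const_smul _), LD_add _ hh (hσ.const_smul _),
      LD_const_smul, LD_const_smul, LD_clm_comp _ _ hd, hD, neg_neg]
    have hD' : LD m P η (XMat m x) (iterL m P η (k+1) (fun _ => x) (LD m P η (hMat m h) f))
        = iterL m P η (k+1+1) (fun _ => x) (LD m P η (hMat m h) f) := rfl
    rw [hD']
    push_cast
    module

variable {V₁ V₂ : Type}
  [NormedAddCommGroup V₁] [NormedSpace ℝ V₁] [NormedAddCommGroup V₂] [NormedSpace ℝ V₂]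

theorem contDiff_nabK (hη : ∀ Z, ContDiff ℝ (⊤ : ℕ∞) (η Z)) {f : P → V}
    (hf : ContDiff ℝ (⊤ : ℕ∞) f) (k : ℕ) (v : Fin k → Rm m) :
    ContDiff ℝ (⊤ : ℕ∞) (nabK m P η k f v) :=
  (ContDiff.sum fun (ν : Equiv.Perm (Fin k)) _ => contDiff_iterL hη hf k (v ∘ ν)).const_smul _

theorem LD_nabK (hη : ∀ Z, ContDiff ℝ (⊤ : ℕ∞) (η Z)) {f : P → V}
    (hf : ContDiff ℝ (⊤ : ℕ∞) f) (Z : Matrix (Idx m) (Idx m) ℝ) (k : ℕ) (v : Fin k → Rm m)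
    (u : P) : LD m P η Z (nabK m P η k f v) u = (k.factorial : ℝ)⁻¹ •
      ∑ ν : Equiv.Perm (Fin k), LD m P η Z (iterL m P η k (v ∘ ν) f) u := by
  have : nabK m P η k f v = (k.factorial : ℝ)⁻¹ •
      ∑ ν : Equiv.Perm (Fin k), iterL m P η k (v ∘ ν) f := by
    ext u; simp [nabK]
  rw [this, LD_const_smul,
    LD_sum _ _ fun ν : Equiv.Perm (Fin k) => (contDiff_iterL hη hf k (v ∘ ν)).differentiable (by simp)]
  simp

theorem Qom_symT_const (hη : ∀ Z, ContDiff ℝ (⊤ : ℕ∞) (η Z))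
    (hηadd : ∀ Z Z' u, η (Z + Z') u = η Z u + η Z' u)
    (hηsmul : ∀ (c : ℝ) Z u, η (c • Z) u = c • η Z u) {f : P → V₁}
    (hf : ContDiff ℝ (⊤ : ℕ∞) f) {k : ℕ} (x : Rm m) (A : V₁ →L[ℝ] V₂) (u : P) :
    Qom m P V₁ V₂ η (fun _ => symT m V₁ V₂ (fun _ : Fin k => x) A) f u
      = A (iterL m P η k (fun _ => x) f u) := by
  rw [iterL_const_eq_sum hη hηadd hηsmul x hf, Finset.sum_apply]
  exact sum_perm_prod_smul_comp x A fun d => iterL m P η k (fun t => Pi.single (d t) 1) f u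

/-- The contraction of a symbol with the derivative along `ω^{-1}(Z)` of `(∇^ω)^k f`. -/
def pairLD (η : Matrix (Idx m) (Idx m) ℝ → P → P) (Z : Matrix (Idx m) (Idx m) ℝ) {k : ℕ}
    (f : P → V₁) (u : P) (S : Symb m V₁ V₂ k) : V₂ :=
  (k.factorial : ℝ)⁻¹ • ∑ d : Fin k → Fin m, (S (fun t => coordD m (d t)))
    (LD m P η Z (nabK m P η k f (fun t => Pi.single (d t) 1)) u)

theorem pairLD_symT_const (hη : ∀ Z, ContDiff ℝ (⊤ : ℕ∞) (η Z))
    (hηadd : ∀ Z Z' u, η (Z + Z') u = η Z u + η Z' u)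
    (hηsmul : ∀ (c : ℝ) Z u, η (c • Z) u = c • η Z u) {f : P → V₁}
    (hf : ContDiff ℝ (⊤ : ℕ∞) f) (Z : Matrix (Idx m) (Idx m) ℝ) {k : ℕ} (x : Rm m)
    (A : V₁ →L[ℝ] V₂) (u : P) :
    pairLD η Z f u (symT m V₁ V₂ (fun _ : Fin k => x) A)
      = A (LD m P η Z (iterL m P η k (fun _ => x) f) u) := by
  have hd (d : Fin k → Fin m) : Differentiable ℝ
      ((∏ t, x (d t)) • iterL m P η k (fun t => Pi.single (d t) 1) f) :=
    ((contDiff_iterL hη hf k _).differentiable (by simp)).const_smul _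
  rw [iterL_const_eq_sum hη hηadd hηsmul x hf, LD_sum _ _ hd, Finset.sum_apply]
  simp_rw [LD_const_smul, pairLD, LD_nabK hη hf]
  exact sum_perm_prod_smul_comp x A
    fun d => LD m P η Z (iterL m P η k (fun t => Pi.single (d t) 1) f) u

theorem LD_Qom (hη : ∀ Z, ContDiff ℝ (⊤ : ℕ∞) (η Z)) {f : P → V₁}
    (hf : ContDiff ℝ (⊤ : ℕ∞) f) (Z : Matrix (Idx m) (Idx m) ℝ) {k : ℕ}
    {T : P → Symb m V₁ V₂ k} (hT : Differentiable ℝ T) (u : P) :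
    LD m P η Z (Qom m P V₁ V₂ η T f) u
      = Qom m P V₁ V₂ η (LD m P η Z T) f u + pairLD η Z f u (T u) := by
  have hn (d : Fin k → Fin m) : HasFDerivAt (nabK m P η k f (fun t => Pi.single (d t) 1)) _ u :=
    ((contDiff_nabK hη hf k _).differentiable (by simp) u).hasFDerivAt
  have hTd (d : Fin k → Fin m) :
      HasFDerivAt (fun u => T u (fun t => coordD m (d t)))
        ((ContinuousMultilinearMap.apply ℝ (fun _ : Fin k => Dualm m) (V₁ →L[ℝ] V₂)
          (fun t => coordD m (d t))).comp (fderiv ℝ T u)) u := by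
    exact (hT u).hasFDerivAt.continuousMultilinear_apply_const _
  have := (HasFDerivAt.fun_sum (u := Finset.univ)
    fun d _ => (hTd d).clm_apply (hn d)).const_smul (k.factorial : ℝ)⁻¹
  have he : fderiv ℝ (Qom m P V₁ V₂ η T f) u = _ := this.fderiv
  rw [LD, he, Qom, pairLD, ← smul_add, ← Finset.sum_add_distrib]
  simp only [smul_apply, sum_apply]
  congr 1
  refine Finset.sum_congr rfl fun d _ => ?_
  simp [LD, add_comm]

theorem pairLD_hMat_eq (hη : ∀ Z, ContDiff ℝ (⊤ : ℕ∞) (η Z))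
    (hηadd : ∀ Z Z' u, η (Z + Z') u = η Z u + η Z' u)
    (hηsmul : ∀ (c : ℝ) Z u, η (c • Z) u = c • η Z u)
    (hbr : BracketCompat m P η) {σ₁ : GLm m →ₗ[ℝ] (V₁ →L[ℝ] V₁)} {k : ℕ}
    {γ : Dualm m → (Symb m V₁ V₂ (k+1) →ₗ[ℝ] Symb m V₁ V₂ k)} (hγ : gammaProp m V₁ V₂ σ₁ γ)
    {f : P → V₁} (hf : ContDiff ℝ (⊤ : ℕ∞) f) (hfeq : equivG0 m P η (fun B u => σ₁ B u) f)
    (h : Dualm m) (u : P) {S : Symb m V₁ V₂ (k+1)} (hS : S ∈ spanGen m V₁ V₂ (k+1)) :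
    pairLD η (hMat m h) f u S = Qom m P V₁ V₂ η (fun _ => S) (LD m P η (hMat m h) f) u
      + Qom m P V₁ V₂ η (fun _ => γ h S) f u := by
  replace hS := spanGen_le_span_symT_const _ hS
  induction hS using Submodule.span_induction with
  | mem S hS =>
    obtain ⟨x, A, rfl⟩ := hS
    have hsub (S S' : Symb m V₁ V₂ k) (a b : ℝ) :
        Qom m P V₁ V₂ η (fun _ => a • S - b • S') f u
          = a • Qom m P V₁ V₂ η (fun _ => S) f u - b • Qom m P V₁ V₂ η (fun _ => S') f u := by
      simp only [Qom, sub_apply, smul_apply,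
        sub_apply, smul_apply, Finset.sum_sub_distrib,
        ← Finset.smul_sum]
      module
    rw [pairLD_symT_const hη hηadd hηsmul hf, hγ.symT_const, hsub,
      Qom_symT_const hη hηadd hηsmul hf, Qom_symT_const hη hηadd hηsmul hf,
      Qom_symT_const hη hηadd hηsmul (contDiff_LD hη _ hf),
      LD_hMat_iterL_const hη hηadd hηsmul hbr hf hfeq]
    simp [add_sub_assoc]
  | zero => simp [pairLD, Qom]
  | add S S' _ _ hS hS' =>
    have hQ {l : ℕ} (R R' : Symb m V₁ V₂ l) (g : P → V₁) :
        Qom m P V₁ V₂ η (fun _ => R + R') g u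
          = Qom m P V₁ V₂ η (fun _ => R) g u + Qom m P V₁ V₂ η (fun _ => R') g u := by
      simp [Qom, Finset.sum_add_distrib]
    have hp : pairLD η (hMat m h) f u (S + S')
        = pairLD η (hMat m h) f u S + pairLD η (hMat m h) f u S' := by
      simp [pairLD, Finset.sum_add_distrib]
    rw [hp, map_add, hQ, hQ, hS, hS']
    abel
  | smul c S _ hS =>
    have hQ {l : ℕ} (R : Symb m V₁ V₂ l) (g : P → V₁) :
        Qom m P V₁ V₂ η (fun _ => c • R) g u = c • Qom m P V₁ V₂ η (fun _ => R) g u := by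
      simp only [Qom, smul_apply, smul_apply,
        ← Finset.smul_sum]
      rw [smul_comm]
    have hp : pairLD η (hMat m h) f u (c • S) = c • pairLD η (hMat m h) f u S := by
      simp only [pairLD, smul_apply, smul_apply,
        ← Finset.smul_sum]
      rw [smul_comm]
    rw [hp, map_smul, hQ, hQ, hS, smul_add]

end Curved

/-- the curved keystone identity:
`L_{ω^{-1}(h)}(Q_ω(T)f) - Q_ω(T)(L_{ω^{-1}(h)}f) = Q_ω(L_{ω^{-1}(h)}T + γ(h)∘T)(f)`. -/
theorem statement15 (m k : ℕ) (hm : 2 ≤ m)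
    (V₁ V₂ : Type) [NormedAddCommGroup V₁] [NormedSpace ℝ V₁] [FiniteDimensional ℝ V₁]
    [NormedAddCommGroup V₂] [NormedSpace ℝ V₂] [FiniteDimensional ℝ V₂]
    (σ₁ : GLm m →ₗ[ℝ] (V₁ →L[ℝ] V₁)) (hσ₁ : IsLieRep m σ₁)
    (P : Type) [NormedAddCommGroup P] [NormedSpace ℝ P] [FiniteDimensional ℝ P]
    (hdim : Module.finrank ℝ P = (m+1)^2 - 1)
    (η : Matrix (Idx m) (Idx m) ℝ → P → P)
    (hηsm : ∀ Z, ContDiff ℝ (⊤ : ℕ∞) (η Z))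
    (hηadd : ∀ Z Z' u, η (Z + Z') u = η Z u + η Z' u)
    (hηsmul : ∀ (c : ℝ) Z u, η (c • Z) u = c • η Z u)
    (hbr : BracketCompat m P η)
    (γ : Dualm m → (Symb m V₁ V₂ (k+1) →ₗ[ℝ] Symb m V₁ V₂ k))
    (hγ : gammaProp m V₁ V₂ σ₁ γ)
    (h : Dualm m)
    (T : P → Symb m V₁ V₂ (k+1)) (hT : ContDiff ℝ (⊤ : ℕ∞) T)
    (hTval : ∀ u, T u ∈ spanGen m V₁ V₂ (k+1))
    (f : P → V₁) (hf : ContDiff ℝ (⊤ : ℕ∞) f)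
    (hfeq : equivG0 m P η (fun B u => σ₁ B u) f) :
    LD m P η (hMat m h) (Qom m P V₁ V₂ η T f)
        - Qom m P V₁ V₂ η T (LD m P η (hMat m h) f)
      = Qom m P V₁ V₂ η (LD m P η (hMat m h) T) f
        + Qom m P V₁ V₂ η (fun u => γ h (T u)) f := by
  ext u
  have hQ := pairLD_hMat_eq hηsm hηadd hηsmul hbr hγ hf hfeq h u (hTval u)
  have hL := LD_Qom hηsm hf (hMat m h) (hT.differentiable (by simp)) u
  rw [Pi.sub_apply, Pi.add_apply, hL, hQ]
  simp only [Qom]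
  abel

end ProjQuant
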